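/- Let G = (V,E) be a φ expander with m edges, where φ ∈ (0,1), and let e_1, …, e_k be distinct edges of G with k ≤ φ·m/10. Then there exist sets ∅ = P_0 ⊆ P_1 ⊆ ⋯ ⊆ P_k ⊆ V such that for every i ∈ {0,…,k}, writing G_i for the graph G with the edges e_1,…,e_i removed: (1) vol_G(P_i) ≤ 8i/φ; (2) |E_G(P_i, V∖P_i)| ≤ 4i; and (3) G_i{V∖P_i} is a φ/6 expander, i.e., for every S ⊆ V∖P_i with vol_{G_i}(S) ≤ vol_{G_i}(V∖P_i)/2 one has |E_{G_i}(S, (V∖P_i)∖S)| ≥ (φ/6)·vol_{G_i}(S). -/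

import Mathlib

/-!
STATEMENT 2 (Expander pruning, Theorem 1.3):
Let `G` be a `φ` expander with `m` edges, `φ ∈ (0,1)`, and let `e₁,…,e_k` be distinct
edges of `G` with `k ≤ φ·m/10`. Then there exist sets `∅ = P₀ ⊆ P₁ ⊆ ⋯ ⊆ P_k ⊆ V`
such that for all `i ≤ k`, writing `Gᵢ` for `G` with `e₁,…,eᵢ` removed:
(1) `vol_G(Pᵢ) ≤ 8i/φ`; (2) `|E_G(Pᵢ, V∖Pᵢ)| ≤ 4i`; (3) `Gᵢ{V∖Pᵢ}` is a `φ/6` expander.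
-/

open Finset

noncomputable section
open scoped Classical

/-- `|E_G(S,T)|`: the number of edges of `G` with one endpoint in `S` and the other in `T`. -/
def eCount {V : Type*} [Fintype V] [DecidableEq V] (G : SimpleGraph V) (S T : Finset V) : ℕ :=
  ((S ×ˢ T).filter fun p => G.Adj p.1 p.2).card

/-- `vol_G(S) = ∑_{v ∈ S} deg_G(v)`. -/
def vol {V : Type*} [Fintype V] [DecidableEq V] (G : SimpleGraph V) (S : Finset V) : ℕ :=
  ∑ v ∈ S, G.degree v

/-- The graph `G` with the first `i` of the edges `e 0, …, e (k-1)` deleted. -/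
def delEdges {V : Type*} (G : SimpleGraph V) {k : ℕ} (e : Fin k → Sym2 V) (i : ℕ) :
    SimpleGraph V :=
  G.deleteEdges {s | ∃ j : Fin k, (j : ℕ) < i ∧ e j = s}

section PruningHelpers
variable {V : Type*} [Fintype V] [DecidableEq V]

lemma eCount_eq_sum (G : SimpleGraph V) (S T : Finset V) :
    eCount G S T = ∑ p : V × V, if p.1 ∈ S ∧ p.2 ∈ T ∧ G.Adj p.1 p.2 then 1 else 0 := by
  unfold eCount
  rw [← Finset.card_filter]
  congr 1
  ext p
  simp [and_assoc]

lemma vol_eq_eCount (G : SimpleGraph V) (S : Finset V) : vol G S = eCount G S univ := by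
  unfold vol eCount
  rw [Finset.card_filter, Finset.sum_product]
  refine Finset.sum_congr rfl fun v _ => ?_
  rw [← Finset.card_filter, ← SimpleGraph.card_neighborFinset_eq_degree]
  congr 1
  ext w
  simp

lemma eCount_union_right (G : SimpleGraph V) (S T U : Finset V) (h : Disjoint T U) :
    eCount G S (T ∪ U) = eCount G S T + eCount G S U := by
  simp only [eCount_eq_sum]
  rw [← Finset.sum_add_distrib]
  refine Finset.sum_congr rfl fun p _ => ?_
  have : p.2 ∈ T → p.2 ∉ U := fun hh => Finset.disjoint_left.mp h hh
  simp only [Finset.mem_union]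
  by_cases h1 : p.1 ∈ S <;> by_cases h2 : p.2 ∈ T <;> by_cases h3 : p.2 ∈ U <;>
    by_cases h4 : G.Adj p.1 p.2 <;> simp_all

lemma eCount_symm (G : SimpleGraph V) (S T : Finset V) : eCount G S T = eCount G T S := by
  unfold eCount
  refine Finset.card_bij (fun p _ => (p.2, p.1)) ?_ ?_ ?_
  · intro p hp
    simp only [Finset.mem_filter, Finset.mem_product] at hp ⊢
    exact ⟨⟨hp.1.2, hp.1.1⟩, hp.2.symm⟩
  · rintro ⟨a, b⟩ _ ⟨c, d⟩ _ h
    simp_all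
  · rintro ⟨a, b⟩ hp
    simp only [Finset.mem_filter, Finset.mem_product] at hp
    exact ⟨(b, a), by simpa using ⟨⟨hp.1.2, hp.1.1⟩, hp.2.symm⟩, rfl⟩

lemma eCount_mono {G H : SimpleGraph V} (h : H ≤ G) (S T : Finset V) :
    eCount H S T ≤ eCount G S T := by
  unfold eCount
  refine Finset.card_le_card fun p hp => ?_
  simp only [Finset.mem_filter] at hp ⊢
  exact ⟨hp.1, h hp.2⟩

lemma cut_submod (G : SimpleGraph V) (P Q : Finset V) :
    eCount G (P ∪ Q) (P ∪ Q)ᶜ + eCount G (P ∩ Q) (P ∩ Q)ᶜ ≤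
      eCount G P Pᶜ + eCount G Q Qᶜ := by
  simp only [eCount_eq_sum]
  rw [← Finset.sum_add_distrib, ← Finset.sum_add_distrib]
  refine Finset.sum_le_sum fun p _ => ?_
  simp only [Finset.mem_union, Finset.mem_inter, Finset.mem_compl]
  by_cases h4 : G.Adj p.1 p.2 <;> by_cases h1 : p.1 ∈ P <;> by_cases h2 : p.2 ∈ P <;>
    by_cases h3 : p.1 ∈ Q <;> by_cases h5 : p.2 ∈ Q <;> simp [h1, h2, h3, h4, h5]

lemma vol_union (G : SimpleGraph V) (S T : Finset V) (h : Disjoint S T) :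
    vol G (S ∪ T) = vol G S + vol G T := Finset.sum_union h

lemma vol_union_inter (G : SimpleGraph V) (S T : Finset V) :
    vol G (S ∪ T) + vol G (S ∩ T) = vol G S + vol G T := Finset.sum_union_inter

lemma vol_mono {G H : SimpleGraph V} (h : H ≤ G) (S : Finset V) : vol H S ≤ vol G S := by
  rw [vol_eq_eCount, vol_eq_eCount]; exact eCount_mono h _ _

/-- The loss of edges between `S` and `T` is at most the loss of volume of `S`. -/
lemma eCount_loss {G H : SimpleGraph V} (h : H ≤ G) (S T : Finset V) :
    eCount G S T + vol H S ≤ eCount H S T + vol G S := by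
  have e1 := eCount_union_right G S T Tᶜ disjoint_compl_right
  have e2 := eCount_union_right H S T Tᶜ disjoint_compl_right
  rw [Finset.union_compl, ← vol_eq_eCount] at e1 e2
  have := eCount_mono h S Tᶜ
  omega

/-- Monotonicity of the volume loss in the set. -/
lemma loss_mono {G H : SimpleGraph V} (h : H ≤ G) {S T : Finset V} (hST : S ⊆ T) :
    vol G S + vol H T ≤ vol G T + vol H S := by
  have e1 := vol_union G S (T \ S) Finset.disjoint_sdiff
  have e2 := vol_union H S (T \ S) Finset.disjoint_sdiff
  rw [Finset.union_sdiff_of_subset hST] at e1 e2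
  have := vol_mono h (T \ S)
  omega

lemma vol_univ (G : SimpleGraph V) : vol G univ = 2 * G.edgeFinset.card :=
  G.sum_degrees_eq_twice_card_edges

lemma delEdges_le (G : SimpleGraph V) {k : ℕ} (e : Fin k → Sym2 V) (i : ℕ) :
    delEdges G e i ≤ G := SimpleGraph.deleteEdges_le _

lemma delEdges_succ_le (G : SimpleGraph V) {k : ℕ} (e : Fin k → Sym2 V) (i : ℕ) :
    delEdges G e (i + 1) ≤ delEdges G e i := by
  intro a b h
  simp only [delEdges, SimpleGraph.deleteEdges_adj, Set.mem_setOf_eq] at h ⊢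
  exact ⟨h.1, fun ⟨j, hj, hj'⟩ => h.2 ⟨j, by omega, hj'⟩⟩

lemma delEdges_vol (G : SimpleGraph V) {k : ℕ} (e : Fin k → Sym2 V) (i : ℕ) :
    vol G univ ≤ vol (delEdges G e i) univ + 2 * i := by
  rw [vol_univ, vol_univ]
  have hsub : G.edgeFinset ⊆ (delEdges G e i).edgeFinset ∪
      (univ.filter fun j : Fin k => (j : ℕ) < i).image e := by
    intro s hs
    simp only [Finset.mem_union, SimpleGraph.mem_edgeFinset, Finset.mem_image,
      Finset.mem_filter, Finset.mem_univ, true_and] at hs ⊢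
    by_cases h : ∃ j : Fin k, (j : ℕ) < i ∧ e j = s
    · exact Or.inr h
    · left
      unfold delEdges
      rw [SimpleGraph.edgeSet_deleteEdges]
      exact ⟨hs, h⟩
  have h1 := Finset.card_le_card hsub
  have h2 := Finset.card_union_le (delEdges G e i).edgeFinset
    ((univ.filter fun j : Fin k => (j : ℕ) < i).image e)
  have h3 : ((univ.filter fun j : Fin k => (j : ℕ) < i).image e).card ≤
      (univ.filter fun j : Fin k => (j : ℕ) < i).card := Finset.card_image_le
  have h4 : (univ.filter fun j : Fin k => (j : ℕ) < i).card ≤ i := by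
    have : (univ.filter fun j : Fin k => (j : ℕ) < i).card ≤ (Finset.range i).card :=
      Finset.card_le_card_of_injOn (fun j => (j : ℕ)) (by intro j hj; simpa using hj)
        (fun a _ b _ h => Fin.ext h)
    simpa using this
  omega

/-- The min-cut potential. -/
def pot (G H : SimpleGraph V) (φ : ℝ) (P : Finset V) : ℝ :=
  eCount G P Pᶜ + φ / 2 * vol G P - 2 * ((vol G P : ℝ) - vol H P)

lemma pot_empty (G H : SimpleGraph V) (φ : ℝ) : pot G H φ ∅ = 0 := by
  simp [pot, eCount, vol]

lemma pot_step {G H H' : SimpleGraph V} (hle : H' ≤ H) (φ : ℝ) (P Q : Finset V)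
    (hP : ∀ R, pot G H φ P ≤ pot G H φ R) (hQ : ∀ R, pot G H' φ Q ≤ pot G H' φ R) :
    ∀ R, pot G H' φ (P ∪ Q) ≤ pot G H' φ R := by
  intro R
  refine le_trans ?_ (hQ R)
  have h1 := hP (P ∩ Q)
  have h2 : ((eCount G (P ∪ Q) (P ∪ Q)ᶜ : ℝ) + eCount G (P ∩ Q) (P ∩ Q)ᶜ) ≤
      eCount G P Pᶜ + eCount G Q Qᶜ := by exact_mod_cast cut_submod G P Q
  have h3 : (vol G (P ∪ Q) : ℝ) + vol G (P ∩ Q) = vol G P + vol G Q := by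
    exact_mod_cast vol_union_inter G P Q
  have h4 : (vol H (P ∪ Q) : ℝ) + vol H (P ∩ Q) = vol H P + vol H Q := by
    exact_mod_cast vol_union_inter H P Q
  have h5 : (vol H Q : ℝ) + vol H' (P ∪ Q) ≤ vol H (P ∪ Q) + vol H' Q := by
    exact_mod_cast loss_mono hle (Finset.subset_union_right (s₁ := P) (s₂ := Q))
  have h6 : φ / 2 * (vol G (P ∪ Q) : ℝ) + φ / 2 * vol G (P ∩ Q) =
      φ / 2 * vol G P + φ / 2 * vol G Q := by
    rw [← mul_add, ← mul_add, h3]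
  unfold pot at *
  linarith

lemma pot_cut (G H : SimpleGraph V) (φ : ℝ) (hφ0 : 0 < φ) (hφ1 : φ < 1) (hle : H ≤ G)
    (hexp : ∀ S : Finset V, φ * min (vol G S : ℝ) (vol G Sᶜ : ℝ) ≤ (eCount G S Sᶜ : ℝ))
    (hloss : (vol G univ : ℝ) - vol H univ ≤ φ * vol G univ / 10)
    (P : Finset V) (hP : ∀ R, pot G H φ P ≤ pot G H φ R)
    (S : Finset V) (hS : S ⊆ Pᶜ) (hvol : (vol H S : ℝ) ≤ (vol H Pᶜ : ℝ) / 2) :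
    φ / 6 * (vol H S : ℝ) ≤ eCount H S (Pᶜ \ S) := by
  have hdis : Disjoint P S := by
    rw [Finset.disjoint_left]; intro a ha ha'
    exact (Finset.mem_compl.mp (hS ha')) ha
  have hmin := hP (P ∪ S)
  have eqc : (P ∪ S)ᶜ = Pᶜ \ S := by ext; simp
  have eqc2 : Pᶜ = (Pᶜ \ S) ∪ S := (Finset.sdiff_union_of_subset hS).symm
  have eqc3 : Sᶜ = (Pᶜ \ S) ∪ P := by
    ext a
    have : a ∈ P → a ∉ S := fun hh => Finset.disjoint_left.mp hdis hh
    simp only [Finset.mem_compl, Finset.mem_union, Finset.mem_sdiff]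
    tauto
  have d3 : Disjoint (Pᶜ \ S) P := by
    rw [Finset.disjoint_left]; intro a ha
    simp only [Finset.mem_compl, Finset.mem_sdiff] at ha; exact ha.1
  have c1 : eCount G (P ∪ S) (P ∪ S)ᶜ = eCount G P (Pᶜ \ S) + eCount G S (Pᶜ \ S) := by
    rw [eqc, eCount_symm, eCount_union_right _ _ _ _ hdis, eCount_symm G _ P,
      eCount_symm G _ S]
  have c2 : eCount G P Pᶜ = eCount G P (Pᶜ \ S) + eCount G S P := by
    conv_lhs => rw [eqc2]
    rw [eCount_union_right _ _ _ _ Finset.sdiff_disjoint, eCount_symm G S P]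
  have c3 : eCount G S Sᶜ = eCount G S (Pᶜ \ S) + eCount G S P := by
    rw [eqc3, eCount_union_right _ _ _ _ d3]
  have v1 := vol_union G P S hdis
  have v2 := vol_union H P S hdis
  have v3 : vol H Pᶜ = vol H (Pᶜ \ S) + vol H S := by
    conv_lhs => rw [eqc2]
    exact vol_union _ _ _ Finset.sdiff_disjoint
  have v4 : vol G Sᶜ = vol G (Pᶜ \ S) + vol G P := by
    rw [eqc3]; exact vol_union _ _ _ d3
  have v5 : vol G univ = vol G S + vol G Sᶜ := by
    rw [← Finset.union_compl S]; exact vol_union _ _ _ disjoint_compl_right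
  have v6 := vol_mono hle (Pᶜ \ S)
  have v7 := vol_mono hle S
  have l1 := eCount_loss hle S (Pᶜ \ S)
  have l2 := loss_mono hle (Finset.subset_univ S)
  have hx := hexp S
  unfold pot at hmin
  rw [c1, c2, v1, v2] at hmin
  rw [c3] at hx
  rw [v3] at hvol
  have v4' : (vol G Sᶜ : ℝ) = vol G (Pᶜ \ S) + vol G P := by exact_mod_cast v4
  have v5' : (vol G univ : ℝ) = vol G S + vol G Sᶜ := by exact_mod_cast v5
  have v6' : (vol H (Pᶜ \ S) : ℝ) ≤ vol G (Pᶜ \ S) := by exact_mod_cast v6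
  have v7' : (vol H S : ℝ) ≤ vol G S := by exact_mod_cast v7
  have l1' : (eCount G S (Pᶜ \ S) : ℝ) + vol H S ≤ eCount H S (Pᶜ \ S) + vol G S := by
    exact_mod_cast l1
  have l2' : (vol G S : ℝ) + vol H univ ≤ vol G univ + vol H S := by exact_mod_cast l2
  have hP0 : (0 : ℝ) ≤ vol G P := Nat.cast_nonneg _
  have hS0 : (0 : ℝ) ≤ vol G S := Nat.cast_nonneg _
  have hU0 : (0 : ℝ) ≤ vol G univ := Nat.cast_nonneg _
  push_cast at hmin hx hvol
  rcases le_total (vol G S : ℝ) (vol G Sᶜ) with hc | hc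
  · rw [min_eq_left hc] at hx
    have := mul_le_mul_of_nonneg_left v7' hφ0.le
    have := mul_nonneg hφ0.le hS0
    linarith
  · rw [min_eq_right hc] at hx
    have k1 : (vol H S : ℝ) ≤ vol G Sᶜ := by linarith
    have k2 := mul_le_mul_of_nonneg_left k1 hφ0.le
    have k3 : φ * (vol G univ : ℝ) ≤ vol G univ := by nlinarith
    have k4 : 4 * ((vol G S : ℝ) - vol H S) ≤ vol G S := by linarith
    have k5 := mul_le_mul_of_nonneg_left k4 hφ0.le
    linarith

end PruningHelpers

theorem expander_pruning
    {V : Type*} [Fintype V] [DecidableEq V] (G : SimpleGraph V) (φ : ℝ) (k : ℕ)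
    (e : Fin k → Sym2 V)
    (hφ0 : 0 < φ) (hφ1 : φ < 1)
    -- G is a φ expander
    (hexp : ∀ S : Finset V, S.Nonempty → S ≠ Finset.univ →
      φ * min (vol G S : ℝ) (vol G Sᶜ : ℝ) ≤ (eCount G S Sᶜ : ℝ))
    -- e₁, …, e_k are distinct edges of G
    (he : ∀ j, e j ∈ G.edgeFinset) (hinj : Function.Injective e)
    -- k ≤ φ·m/10
    (hk : (k : ℝ) ≤ φ * G.edgeFinset.card / 10) :
    ∃ P : ℕ → Finset V,
      P 0 = ∅ ∧ (∀ i < k, P i ⊆ P (i + 1)) ∧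
      ∀ i ≤ k,
        -- (1) vol_G(Pᵢ) ≤ 8i/φ
        (vol G (P i) : ℝ) ≤ 8 * i / φ ∧
        -- (2) |E_G(Pᵢ, V∖Pᵢ)| ≤ 4i
        (eCount G (P i) (P i)ᶜ : ℝ) ≤ 4 * i ∧
        -- (3) Gᵢ{V∖Pᵢ} is a φ/6 expander
        (∀ S ⊆ (P i)ᶜ,
          (vol (delEdges G e i) S : ℝ) ≤ (vol (delEdges G e i) (P i)ᶜ : ℝ) / 2 →
          (φ / 6) * (vol (delEdges G e i) S : ℝ) ≤
            (eCount (delEdges G e i) S ((P i)ᶜ \ S) : ℝ)) := by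
  have hexp' : ∀ S : Finset V,
      φ * min (vol G S : ℝ) (vol G Sᶜ : ℝ) ≤ (eCount G S Sᶜ : ℝ) := by
    intro S
    rcases S.eq_empty_or_nonempty with rfl | hne
    · have h1 : min (vol G (∅ : Finset V) : ℝ) (vol G (∅ : Finset V)ᶜ : ℝ) ≤ 0 :=
        (min_le_left _ _).trans (by simp [vol])
      exact (mul_nonpos_of_nonneg_of_nonpos hφ0.le h1).trans (Nat.cast_nonneg _)
    · by_cases hu : S = Finset.univ
      · have h1 : min (vol G S : ℝ) (vol G Sᶜ : ℝ) ≤ 0 :=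
          (min_le_right _ _).trans (by simp [vol, hu])
        exact (mul_nonpos_of_nonneg_of_nonpos hφ0.le h1).trans (Nat.cast_nonneg _)
      · exact hexp S hne hu
  have hQ : ∀ i : ℕ, ∃ Q : Finset V, ∀ R, pot G (delEdges G e i) φ Q ≤
      pot G (delEdges G e i) φ R := fun i => Finite.exists_min _
  choose Q hQ using hQ
  let P : ℕ → Finset V := fun n => Nat.rec ∅ (fun i A => A ∪ Q (i + 1)) n
  have hP0 : P 0 = ∅ := rfl
  have hPs : ∀ i, P (i + 1) = P i ∪ Q (i + 1) := fun _ => rfl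
  have hmin : ∀ i R, pot G (delEdges G e i) φ (P i) ≤ pot G (delEdges G e i) φ R := by
    intro i
    induction i with
    | zero =>
      intro R
      have h0 : delEdges G e 0 = G := by
        unfold delEdges; simp
      rw [hP0, pot_empty, h0]
      unfold pot
      have : (0 : ℝ) ≤ φ / 2 * vol G R := by positivity
      have : (0 : ℝ) ≤ eCount G R Rᶜ := Nat.cast_nonneg _
      linarith
    | succ i ih =>
      rw [hPs]
      exact pot_step (delEdges_succ_le G e i) φ _ _ ih (hQ (i + 1))
  refine ⟨P, hP0, fun i _ => by rw [hPs]; exact Finset.subset_union_left, ?_⟩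
  intro i hi
  have hle := delEdges_le G e i
  have hd : (vol G univ : ℝ) ≤ vol (delEdges G e i) univ + 2 * i := by
    exact_mod_cast delEdges_vol G e i
  have hl : (vol G (P i) : ℝ) + vol (delEdges G e i) univ ≤
      vol G univ + vol (delEdges G e i) (P i) := by
    exact_mod_cast loss_mono hle (Finset.subset_univ (P i))
  have hp := hmin i ∅
  rw [pot_empty] at hp
  unfold pot at hp
  have p1 : (0 : ℝ) ≤ φ / 2 * vol G (P i) := by positivity
  have p2 : (0 : ℝ) ≤ eCount G (P i) (P i)ᶜ := Nat.cast_nonneg _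
  refine ⟨?_, by linarith, ?_⟩
  · rw [le_div_iff₀ hφ0]; linarith
  · intro S hS hv
    refine pot_cut G _ φ hφ0 hφ1 hle hexp' ?_ (P i) (hmin i) S hS hv
    have hm : (vol G univ : ℝ) = 2 * (G.edgeFinset.card : ℝ) := by exact_mod_cast vol_univ G
    have hik : (i : ℝ) ≤ k := by exact_mod_cast hi
    rw [hm] at hd ⊢
    linarith
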